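/- The group with presentation ⟨x, y, z | x⁴ = y² = z² = 1, [x,y] = 1, [y,z] = 1, z⁻¹xz = xy⟩ is isomorphic to the semidirect product (ℤ/4 × ℤ/2) ⋊_φ ℤ/2, where φ sends the generator of ℤ/2 to the automorphism (a, b) ↦ (a, b + ā) of ℤ/4 × ℤ/2 (ā denoting the reduction of a modulo 2). In particular this presented group has order 16. -/

import Mathlib

namespace G16Pres

def x : FreeGroup (Fin 3) := FreeGroup.of 0
def y : FreeGroup (Fin 3) := FreeGroup.of 1
def z : FreeGroup (Fin 3) := FreeGroup.of 2

/-- Relators of ⟨x,y,z ∣ x⁴ = y² = z² = 1, [x,y] = 1, [y,z] = 1, z⁻¹xz = xy⟩. -/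
def rels : Set (FreeGroup (Fin 3)) :=
  {x ^ 4, y ^ 2, z ^ 2,
   x * y * x⁻¹ * y⁻¹,
   y * z * y⁻¹ * z⁻¹,
   (z⁻¹ * x * z) * (x * y)⁻¹}

/-- The involutive automorphism (a, b) ↦ (a, b + ā) of ℤ/4 × ℤ/2,
where ā is the reduction of a modulo 2. -/
def σAdd : ZMod 4 × ZMod 2 ≃+ ZMod 4 × ZMod 2 where
  toFun p := (p.1, p.2 + (p.1.val : ZMod 2))
  invFun p := (p.1, p.2 + (p.1.val : ZMod 2))
  left_inv := by decide
  right_inv := by decide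
  map_add' := by decide

end G16Pres

namespace G16Pres

/-- The homomorphism from the cyclic group of order `n` sending the generator to `g`,
where `g ^ n = 1`. -/
def zmodPowersHom {G : Type*} [Group G] (n : ℕ) [NeZero n] (g : G) (hg : g ^ n = 1) :
    Multiplicative (ZMod n) →* G where
  toFun a := g ^ a.toAdd.val
  map_one' := by simp
  map_mul' a b := by
    rw [toAdd_mul, ZMod.val_add, ← pow_add, ← pow_eq_pow_mod _ hg]

theorem zmodPowersHom_ofAdd_one {G : Type*} [Group G] (n : ℕ) [NeZero n] (g : G)
    (hg : g ^ n = 1) : zmodPowersHom n g hg (.ofAdd 1) = g := by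
  change g ^ (1 : ZMod n).val = g
  rw [ZMod.val_one_eq_one_mod, ← pow_eq_pow_mod _ hg, pow_one]

theorem σAdd_sq :
    (AddEquiv.toMultiplicative σAdd : MulAut (Multiplicative (ZMod 4 × ZMod 2))) ^ 2 = 1 := by
  ext p : 1
  exact σAdd.left_inv p

/-- The action of `ℤ/2` on `ℤ/4 × ℤ/2` whose generator acts by `σAdd`. -/
def action : Multiplicative (ZMod 2) →* MulAut (Multiplicative (ZMod 4 × ZMod 2)) :=
  zmodPowersHom 2 (AddEquiv.toMultiplicative σAdd) σAdd_sq

theorem action_ofAdd_one : action (.ofAdd 1) = AddEquiv.toMultiplicative σAdd :=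
  zmodPowersHom_ofAdd_one ..

/-- The semidirect product `(ℤ/4 × ℤ/2) ⋊ ℤ/2`. -/
abbrev Semidirect : Type :=
  Multiplicative (ZMod 4 × ZMod 2) ⋊[action] Multiplicative (ZMod 2)

/-- The images of the three generators in the semidirect product. -/
def generators : Fin 3 → Semidirect :=
  ![.inl (.ofAdd (1, 0)), .inl (.ofAdd (0, 1)), .inr (.ofAdd 1)]

theorem lift_generators_eq_one : ∀ r ∈ rels, FreeGroup.lift generators r = 1 := by
  rintro r (rfl | rfl | rfl | rfl | rfl | rfl) <;>
    simp only [x, y, z, map_mul, map_inv, map_pow, FreeGroup.lift_apply_of] <;>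
    decide

/-- The homomorphism from the presented group to the semidirect product. -/
def toSemidirect : PresentedGroup rels →* Semidirect :=
  PresentedGroup.toGroup lift_generators_eq_one

section Lift

variable {G : Type*} [Group G] {a b c : G}

/-- The homomorphism from `ℤ/4 × ℤ/2` determined by commuting elements of orders dividing
`4` and `2`. -/
def prodHom (ha : a ^ 4 = 1) (hb : b ^ 2 = 1) (hab : Commute a b) :
    Multiplicative (ZMod 4 × ZMod 2) →* G :=
  ((zmodPowersHom 4 a ha).noncommCoprod (zmodPowersHom 2 b hb)
    fun _ _ => hab.pow_pow _ _).comp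
      (MulEquiv.prodMultiplicative (ZMod 4) (ZMod 2)).toMonoidHom

theorem prodHom_apply (ha : a ^ 4 = 1) (hb : b ^ 2 = 1) (hab : Commute a b)
    (p : Multiplicative (ZMod 4 × ZMod 2)) :
    prodHom ha hb hab p = a ^ p.toAdd.1.val * b ^ p.toAdd.2.val :=
  rfl

theorem prodHom_σAdd (ha : a ^ 4 = 1) (hb : b ^ 2 = 1) (hab : Commute a b)
    (hbc : Commute b c) (hconj : c * a * c⁻¹ = a * b) (p : Multiplicative (ZMod 4 × ZMod 2)) :
    prodHom ha hb hab (AddEquiv.toMultiplicative σAdd p) = c * prodHom ha hb hab p * c⁻¹ := by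
  have hσ : (σAdd p.toAdd).2.val = (p.toAdd.1.val + p.toAdd.2.val) % 2 := by
    revert p; decide
  have hcb : c * b ^ p.toAdd.2.val * c⁻¹ = b ^ p.toAdd.2.val := by
    rw [((hbc.pow_left _).eq).symm, mul_inv_cancel_right]
  calc prodHom ha hb hab (AddEquiv.toMultiplicative σAdd p)
      = a ^ p.toAdd.1.val * b ^ (σAdd p.toAdd).2.val := rfl
    _ = (a * b) ^ p.toAdd.1.val * b ^ p.toAdd.2.val := by
      rw [hσ, ← pow_eq_pow_mod _ hb, hab.mul_pow, pow_add, mul_assoc]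
    _ = c * prodHom ha hb hab p * c⁻¹ := by
      rw [← hconj, conj_pow, prodHom_apply]
      nth_rewrite 1 [← hcb]
      group

/-- The homomorphism from the semidirect product determined by elements satisfying the
defining relations of the presented group. -/
def semidirectLift (ha : a ^ 4 = 1) (hb : b ^ 2 = 1) (hc : c ^ 2 = 1) (hab : Commute a b)
    (hbc : Commute b c) (hconj : c * a * c⁻¹ = a * b) : Semidirect →* G :=
  SemidirectProduct.lift (prodHom ha hb hab) (zmodPowersHom 2 c hc) fun g => by
    obtain rfl | rfl : g = 1 ∨ g = .ofAdd 1 := by revert g; decide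
    · ext; simp
    · refine MonoidHom.ext fun p => ?_
      simpa [action_ofAdd_one, zmodPowersHom_ofAdd_one] using prodHom_σAdd ha hb hab hbc hconj p

theorem semidirectLift_apply (ha : a ^ 4 = 1) (hb : b ^ 2 = 1) (hc : c ^ 2 = 1)
    (hab : Commute a b) (hbc : Commute b c) (hconj : c * a * c⁻¹ = a * b) (s : Semidirect) :
    semidirectLift ha hb hc hab hbc hconj s =
      a ^ s.left.toAdd.1.val * b ^ s.left.toAdd.2.val * c ^ s.right.toAdd.val :=
  rfl

end Lift

section Presented

open PresentedGroup

local notation "X" => (PresentedGroup.of 0 : PresentedGroup rels)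
local notation "Y" => (PresentedGroup.of 1 : PresentedGroup rels)
local notation "Z" => (PresentedGroup.of 2 : PresentedGroup rels)

theorem of_zero_pow : X ^ 4 = 1 :=
  one_of_mem (x := x ^ 4) (by simp [rels])

theorem of_one_pow : Y ^ 2 = 1 :=
  one_of_mem (x := y ^ 2) (by simp [rels])

theorem of_two_pow : Z ^ 2 = 1 :=
  one_of_mem (x := z ^ 2) (by simp [rels])

theorem commute_of_zero_of_one : Commute X Y :=
  commutatorElement_eq_one_iff_commute.mp
    (one_of_mem (x := x * y * x⁻¹ * y⁻¹) (by simp [rels]))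

theorem commute_of_one_of_two : Commute Y Z :=
  commutatorElement_eq_one_iff_commute.mp
    (one_of_mem (x := y * z * y⁻¹ * z⁻¹) (by simp [rels]))

theorem conj_of_two_of_zero : Z * X * Z⁻¹ = X * Y := by
  have h : Z⁻¹ * X * Z = X * Y :=
    mul_inv_eq_one.mp (one_of_mem (x := (z⁻¹ * x * z) * (x * y)⁻¹) (by simp [rels]))
  have hinv : Z⁻¹ = Z := inv_eq_of_mul_eq_one_left ((sq Z).symm.trans of_two_pow)
  rwa [hinv] at h ⊢

/-- The homomorphism from the semidirect product to the presented group. -/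
def ofSemidirect : Semidirect →* PresentedGroup rels :=
  semidirectLift of_zero_pow of_one_pow of_two_pow commute_of_zero_of_one
    commute_of_one_of_two conj_of_two_of_zero

theorem ofSemidirect_comp_toSemidirect :
    ofSemidirect.comp toSemidirect = MonoidHom.id (PresentedGroup rels) := by
  ext i
  fin_cases i <;>
    simp [toSemidirect, generators, ofSemidirect, semidirectLift_apply, ZMod.val_one_eq_one_mod]

theorem generators_normal_form (s : Semidirect) :
    generators 0 ^ s.left.toAdd.1.val * generators 1 ^ s.left.toAdd.2.val *
      generators 2 ^ s.right.toAdd.val = s := by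
  obtain ⟨p, c⟩ := s
  revert p c
  decide

theorem toSemidirect_comp_ofSemidirect :
    toSemidirect.comp ofSemidirect = MonoidHom.id Semidirect := by
  refine MonoidHom.ext fun s => ?_
  simp only [MonoidHom.comp_apply, ofSemidirect, semidirectLift_apply, map_mul, map_pow,
    toSemidirect, toGroup.of, generators_normal_form, MonoidHom.id_apply]

/-- The presented group is isomorphic to the semidirect product. -/
def equivSemidirect : PresentedGroup rels ≃* Semidirect :=
  toSemidirect.toMulEquiv ofSemidirect ofSemidirect_comp_toSemidirect
    toSemidirect_comp_ofSemidirect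

end Presented

end G16Pres

/-- The group presented by ⟨x,y,z ∣ x⁴ = y² = z² = 1, [x,y] = [y,z] = 1, z⁻¹xz = xy⟩
is isomorphic to the semidirect product (ℤ/4 × ℤ/2) ⋊_φ ℤ/2, where φ sends the generator
of ℤ/2 to the automorphism (a,b) ↦ (a, b + ā); in particular the presented group has
order 16. -/
theorem presentedGroup_iso_semidirect :
    ∃ φ : Multiplicative (ZMod 2) →* MulAut (Multiplicative (ZMod 4 × ZMod 2)),
      φ (Multiplicative.ofAdd 1) = AddEquiv.toMultiplicative G16Pres.σAdd ∧
      Nonempty (PresentedGroup G16Pres.rels ≃*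
        Multiplicative (ZMod 4 × ZMod 2) ⋊[φ] Multiplicative (ZMod 2)) ∧
      Nat.card (PresentedGroup G16Pres.rels) = 16 := by
  refine ⟨G16Pres.action, G16Pres.action_ofAdd_one, ⟨G16Pres.equivSemidirect⟩, ?_⟩
  rw [Nat.card_congr G16Pres.equivSemidirect.toEquiv, SemidirectProduct.card]
  simp
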